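/- Let n ≥ 2, let α_n be an optimal set of n-means for P, and let c ∈ α_n. Then there exists a nonempty word ω over ℕ such that c = a(ω) or c = a(ω,∞). -/

import Mathlib

open MeasureTheory

noncomputable section

/-- The contractive similarity `S j x = x / 2^(j+1) + 1 - 1/2^(j-1)` (used for `j ≥ 1`). -/
def S (j : ℕ) (x : ℝ) : ℝ := x / 2 ^ (j + 1) + 1 - 1 / 2 ^ (j - 1)

/-- The similarity ratio `s j = 1/2^(j+1)`. -/
def s (j : ℕ) : ℝ := 1 / 2 ^ (j + 1)

/-- The probability vector: `p 1 = 1/4`, `p j = 3/2^(j+1)` for `j ≥ 2`. -/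
def p (j : ℕ) : ℝ := if j = 1 then 1 / 4 else 3 / 2 ^ (j + 1)

/-- `Sw ω = S_{ω_1} ∘ ⋯ ∘ S_{ω_k}`. -/
def Sw (ω : List ℕ) : ℝ → ℝ := ω.foldr (fun j f => S j ∘ f) id

/-- `pw ω = p_{ω_1} ⋯ p_{ω_k}`. -/
def pw (ω : List ℕ) : ℝ := (ω.map p).prod

/-- `sw ω = s_{ω_1} ⋯ s_{ω_k}`. -/
def sw (ω : List ℕ) : ℝ := (ω.map s).prod

/-- The basic interval `J_ω = S_ω([0,1])`. -/
def Jw (ω : List ℕ) : Set ℝ := Sw ω '' Set.Icc 0 1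

/-- The last letter of a word (junk value `0` for the empty word). -/
def wlast (ω : List ℕ) : ℕ := ω.getLastD 0

/-- `wext ω j = ω^-(ω_k + j)`: the word `ω` with its last letter increased by `j`. -/
def wext (ω : List ℕ) (j : ℕ) : List ℕ := ω.dropLast ++ [wlast ω + j]

/-- `J_{(ω,∞)} = ⋃_{j=1}^∞ J_{ω^-(ω_k+j)}`. -/
def Jinf (ω : List ℕ) : Set ℝ := ⋃ j : ℕ, Jw (wext ω (j + 1))

/-- `a(ω) = S_ω(4/7)`. -/
def aw (ω : List ℕ) : ℝ := Sw ω (4 / 7)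

/-- `a(ω,∞) = S_{ω^-(ω_k+1)}(4/7) + (8/7) s_{ω^-(ω_k+1)}`. -/
def ainf (ω : List ℕ) : ℝ := Sw (wext ω 1) (4 / 7) + (8 / 7) * sw (wext ω 1)

/-- A (nonempty) word over the alphabet `{1, 2, 3, …}`. -/
def IsWord (ω : List ℕ) : Prop := ω ≠ [] ∧ ∀ i ∈ ω, 1 ≤ i

/-- The invariance relation `P(A) = ∑_{j=1}^∞ p_j P(S_j⁻¹ A)`. -/
def Invariant (P : Measure ℝ) : Prop :=
  ∀ A : Set ℝ, MeasurableSet A →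
    P A = ∑' j : ℕ, ENNReal.ofReal (p (j + 1)) * P (S (j + 1) ⁻¹' A)

/-- The distortion error `∫ min_{a ∈ α} (x-a)² dP` of a set `α ⊆ ℝ`. -/
def distortion (P : Measure ℝ) (α : Set ℝ) : ℝ :=
  ∫ x, (⨅ a : α, (x - (a : ℝ)) ^ 2) ∂P

/-- The `n`-th quantization error for `P`. -/
def quantErr (P : Measure ℝ) (n : ℕ) : ℝ :=
  sInf {r : ℝ | ∃ α : Set ℝ, 1 ≤ α.ncard ∧ α.ncard ≤ n ∧ r = distortion P α}

/-- `α` is an optimal set of `n`-means for `P`. -/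
def IsOptimal (P : Measure ℝ) (n : ℕ) (α : Set ℝ) : Prop :=
  1 ≤ α.ncard ∧ α.ncard ≤ n ∧ distortion P α = quantErr P n

/-- `E(a(ω)) = ∫_{J_ω} (x - a(ω))² dP`. -/
def Ea (P : Measure ℝ) (ω : List ℕ) : ℝ := ∫ x in Jw ω, (x - aw ω) ^ 2 ∂P

/-- `E(a(ω,∞)) = ∫_{J_{(ω,∞)}} (x - a(ω,∞))² dP`. -/
def Eainf (P : Measure ℝ) (ω : List ℕ) : ℝ := ∫ x in Jinf ω, (x - ainf ω) ^ 2 ∂P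

/-- The Voronoi region `M(a|α)`. -/
def voronoi (α : Set ℝ) (a : ℝ) : Set ℝ := {x : ℝ | ∀ b ∈ α, |x - a| ≤ |x - b|}

/-- left map -/
def fL (x : ℝ) : ℝ := x / 4
/-- right map -/
def gR (x : ℝ) : ℝ := 1 / 2 + x / 2

/-- squared distance to the set -/
def dd (α : Set ℝ) (x : ℝ) : ℝ := ⨅ a : α, (x - (a : ℝ)) ^ 2

structure Sys (P Q : Measure ℝ) : Prop where
  probP : IsProbabilityMeasure P
  probQ : IsProbabilityMeasure Q
  aeP : ∀ᵐ x ∂P, x ∈ Set.Icc (0:ℝ) 1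
  aeQ : ∀ᵐ x ∂Q, x ∈ Set.Icc (0:ℝ) 1
  eqP : ∀ h : ℝ → ℝ, Continuous h →
    ∫ x, h x ∂P = 1 / 4 * ∫ x, h (fL x) ∂P + 3 / 4 * ∫ x, h (gR x) ∂Q
  eqQ : ∀ h : ℝ → ℝ, Continuous h →
    ∫ x, h x ∂Q = 1 / 2 * ∫ x, h (fL x) ∂P + 1 / 2 * ∫ x, h (gR x) ∂Q

lemma intg (μ : Measure ℝ) [IsProbabilityMeasure μ] (hae : ∀ᵐ x ∂μ, x ∈ Set.Icc (0:ℝ) 1)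
    (h : ℝ → ℝ) (hc : Continuous h) : Integrable h μ := by
  obtain ⟨C, hC⟩ := isCompact_Icc.exists_bound_of_continuousOn (s := Set.Icc (0:ℝ) 1) hc.continuousOn
  exact Integrable.of_bound hc.aestronglyMeasurable C (hae.mono fun x hx => hC x hx)

lemma fL_cont : Continuous fL := by unfold fL; fun_prop
lemma gR_cont : Continuous gR := by unfold gR; fun_prop
lemma S_meas (j : ℕ) : Measurable (S j) := by unfold S; fun_prop

lemma S_one : S 1 = fL := by ext x; simp [S, fL]; norm_num
lemma S_succ (j : ℕ) (x : ℝ) : S (j + 2) x = gR (S (j + 1) x) := by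
  simp only [S, gR, Nat.add_sub_cancel]
  have : j + 2 - 1 = j + 1 := by omega
  rw [this]; field_simp; ring

lemma S_mem (j : ℕ) (x : ℝ) (hx : x ∈ Set.Icc (0:ℝ) 1) : S (j + 1) x ∈ Set.Icc (0:ℝ) 1 := by
  induction j with
  | zero => simp only [zero_add, S_one, fL]; constructor <;> [linarith [hx.1]; linarith [hx.2]]
  | succ k ih => rw [S_succ]; simp only [gR]; constructor <;> [linarith [ih.1]; linarith [ih.2]]

lemma int_split (μ ν ρ : Measure ℝ) [IsProbabilityMeasure μ] [IsProbabilityMeasure ν]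
    (hμ : ∀ᵐ x ∂μ, x ∈ Set.Icc (0:ℝ) 1) (hν : ∀ᵐ x ∂ν, x ∈ Set.Icc (0:ℝ) 1)
    (a b : ℝ) (ha : 0 ≤ a) (hb : 0 ≤ b)
    (h0 : ρ = ENNReal.ofReal a • μ.map fL + ENNReal.ofReal b • ν.map gR)
    (h : ℝ → ℝ) (hc : Continuous h) :
    ∫ x, h x ∂ρ = a * ∫ x, h (fL x) ∂μ + b * ∫ x, h (gR x) ∂ν := by
  have i1 : Integrable h (μ.map fL) := by
    rw [integrable_map_measure hc.aestronglyMeasurable fL_cont.aemeasurable]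
    exact intg μ hμ _ (hc.comp fL_cont)
  have i2 : Integrable h (ν.map gR) := by
    rw [integrable_map_measure hc.aestronglyMeasurable gR_cont.aemeasurable]
    exact intg ν hν _ (hc.comp gR_cont)
  rw [h0, integral_add_measure (i1.smul_measure ENNReal.ofReal_ne_top)
    (i2.smul_measure ENNReal.ofReal_ne_top), integral_smul_measure, integral_smul_measure,
    integral_map fL_cont.aemeasurable hc.aestronglyMeasurable,
    integral_map gR_cont.aemeasurable hc.aestronglyMeasurable,
    ENNReal.toReal_ofReal ha, ENNReal.toReal_ofReal hb]
  simp

lemma exists_sys (P : Measure ℝ) [IsProbabilityMeasure P]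
    (hsupp : P (Set.Icc 0 1) = 1) (hinv : Invariant P) : ∃ Q, Sys P Q := by
  let Q : Measure ℝ := Measure.sum (fun j : ℕ => ENNReal.ofReal ((1/2)^(j+1)) • P.map (S (j+1)))
  have hQ : ∀ A, MeasurableSet A →
      Q A = ∑' j : ℕ, ENNReal.ofReal ((1/2)^(j+1)) * P (S (j+1) ⁻¹' A) := by
    intro A hA
    simp only [Q]
    rw [Measure.sum_apply _ hA]
    congr 1; ext j
    rw [Measure.smul_apply, Measure.map_apply (S_meas _) hA, smul_eq_mul]
  have hcomp : ∀ (j : ℕ) (A : Set ℝ), S (j + 1 + 1) ⁻¹' A = S (j+1) ⁻¹' (gR ⁻¹' A) := by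
    intro j A; ext x; simp only [Set.mem_preimage]; rw [show j + 1 + 1 = j + 2 from rfl, S_succ]
  have mP : P = ENNReal.ofReal (1/4) • P.map fL + ENNReal.ofReal (3/4) • Q.map gR := by
    ext A hA
    rw [Measure.add_apply, Measure.smul_apply, Measure.smul_apply,
      Measure.map_apply fL_cont.measurable hA, Measure.map_apply gR_cont.measurable hA,
      hQ _ (gR_cont.measurable hA), hinv A hA, tsum_eq_zero_add' ENNReal.summable, smul_eq_mul, smul_eq_mul,
      ← ENNReal.tsum_mul_left]
    congr 1
    · simp [p, S_one]
    · congr 1; ext j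
      rw [hcomp, ← mul_assoc, ← ENNReal.ofReal_mul (by norm_num)]
      congr 2
      simp only [p]; rw [if_neg (by omega)]
      simp only [one_div, inv_pow]; field_simp; ring
  have mQ : Q = ENNReal.ofReal (1/2) • P.map fL + ENNReal.ofReal (1/2) • Q.map gR := by
    ext A hA
    rw [Measure.add_apply, Measure.smul_apply, Measure.smul_apply,
      Measure.map_apply fL_cont.measurable hA, Measure.map_apply gR_cont.measurable hA,
      hQ _ (gR_cont.measurable hA), hQ A hA, tsum_eq_zero_add' ENNReal.summable, smul_eq_mul, smul_eq_mul,
      ← ENNReal.tsum_mul_left]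
    congr 1
    · simp [S_one]
    · congr 1; ext j
      rw [hcomp, ← mul_assoc, ← ENNReal.ofReal_mul (by norm_num)]
      congr 2
      ring
  have aeP : ∀ᵐ x ∂P, x ∈ Set.Icc (0:ℝ) 1 := by
    exact (mem_ae_iff_prob_eq_one measurableSet_Icc).2 hsupp
  have aeQ : ∀ᵐ x ∂Q, x ∈ Set.Icc (0:ℝ) 1 := by
    rw [ae_iff]
    change Q (Set.Icc (0:ℝ) 1)ᶜ = 0
    rw [hQ _ measurableSet_Icc.compl, ENNReal.tsum_eq_zero]
    intro j
    have : P (S (j+1) ⁻¹' (Set.Icc (0:ℝ) 1)ᶜ) = 0 := by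
      have h0 : P (Set.Icc (0:ℝ) 1)ᶜ = 0 := aeP
      refine measure_mono_null ?_ h0
      intro x hx hx'
      exact hx (S_mem j x hx')
    rw [this, mul_zero]
  have hQp : IsProbabilityMeasure Q := by
    constructor
    have h := hQ Set.univ MeasurableSet.univ
    simp only [Set.preimage_univ, measure_univ, mul_one] at h
    rw [h, ← ENNReal.ofReal_tsum_of_nonneg (fun n => by positivity)]
    · have : ∑' j : ℕ, ((1:ℝ)/2)^(j+1) = 1 := by
        simp_rw [pow_succ]; rw [tsum_mul_right, tsum_geometric_two]; norm_num
      rw [this]; simp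
    · exact (summable_nat_add_iff 1).2 summable_geometric_two
  exact ⟨Q, inferInstance, hQp, aeP, aeQ,
    fun h hc => int_split P Q P aeP aeQ _ _ (by norm_num) (by norm_num) mP h hc,
    fun h hc => int_split P Q Q aeP aeQ _ _ (by norm_num) (by norm_num) mQ h hc⟩

def mA : ℝ := 4 / 7
def mT : ℝ := 3 / 7
def vA : ℝ := 288 / 3577
def vT : ℝ := 344 / 3577

lemma moments {P Q : Measure ℝ} (h : Sys P Q) :
    (∫ x, x ∂P = 4/7 ∧ ∫ x, x ∂Q = 3/7) ∧
      (∫ x, x^2 ∂P = 288/3577 + (4/7)^2 ∧ ∫ x, x^2 ∂Q = 344/3577 + (3/7)^2) := by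
  have := h.probP
  have := h.probQ
  have iP := fun k hk => intg P h.aeP k hk
  have iQ := fun k hk => intg Q h.aeQ k hk
  have a1 := h.eqP (fun x => x) continuous_id
  have a2 := h.eqQ (fun x => x) continuous_id
  have b1 := h.eqP (fun x => x^2) (by fun_prop)
  have b2 := h.eqQ (fun x => x^2) (by fun_prop)
  have e1 : ∫ x, fL x ∂P = 1/4 * ∫ x, x ∂P := by
    rw [← integral_const_mul]; congr 1; ext x; simp only [fL]; ring
  have e2 : ∫ x, gR x ∂Q = 1/2 + 1/2 * ∫ x, x ∂Q := by
    rw [← integral_const_mul, show (1/2 : ℝ) = ∫ x, (1/2:ℝ) ∂Q by simp,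
      ← integral_add (iQ _ (by fun_prop)) (iQ _ (by fun_prop))]
    congr 1; ext x; simp only [gR]; simp; ring
  have e3 : ∫ x, (fL x)^2 ∂P = 1/16 * ∫ x, x^2 ∂P := by
    rw [← integral_const_mul]; congr 1; ext x; simp only [fL]; ring
  have e4 : ∫ x, (gR x)^2 ∂Q = 1/4 + 1/2 * ∫ x, x ∂Q + 1/4 * ∫ x, x^2 ∂Q := by
    have : ∀ x, (gR x)^2 = (1/4 + 1/2 * x) + 1/4 * x^2 := by intro x; simp only [gR]; ring
    simp_rw [this]
    rw [integral_add (iQ _ (by fun_prop)) (iQ _ (by fun_prop)),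
      integral_add (iQ _ (by fun_prop)) (iQ _ (by fun_prop)), integral_const_mul, integral_const_mul]
    simp
  rw [e1, e2] at a1 a2
  rw [e3, e4] at b1 b2
  have c1 : ∫ x, x ∂P = 4/7 := by linarith
  have c2 : ∫ x, x ∂Q = 3/7 := by linarith
  rw [c2] at b1 b2
  refine ⟨⟨c1, c2⟩, by linarith, by linarith⟩

lemma int_sq (μ : Measure ℝ) [IsProbabilityMeasure μ] (hae : ∀ᵐ x ∂μ, x ∈ Set.Icc (0:ℝ) 1)
    (m v : ℝ) (h1 : ∫ x, x ∂μ = m) (h2 : ∫ x, x^2 ∂μ = v + m^2) (r q : ℝ) :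
    ∫ x, (q + r * x)^2 ∂μ = r^2 * v + (q + r * m)^2 := by
  have iQ := fun k hk => intg μ hae k hk
  have : ∀ x : ℝ, (q + r * x)^2 = (q^2 + (2*q*r) * x) + r^2 * x^2 := by intro x; ring
  simp_rw [this]
  rw [integral_add (iQ _ (by fun_prop)) (iQ _ (by fun_prop)),
      integral_add (iQ _ (by fun_prop)) (iQ _ (by fun_prop)), integral_const_mul, integral_const_mul, h1, h2]
  simp; ring

lemma sqP {P Q : Measure ℝ} (h : Sys P Q) (r q : ℝ) :
    ∫ x, (q + r * x)^2 ∂P = r^2 * (288/3577) + (q + r * (4/7))^2 :=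
  have := h.probP
  int_sq P h.aeP _ _ (moments h).1.1 (moments h).2.1 r q

lemma sqQ {P Q : Measure ℝ} (h : Sys P Q) (r q : ℝ) :
    ∫ x, (q + r * x)^2 ∂Q = r^2 * (344/3577) + (q + r * (3/7))^2 :=
  have := h.probQ
  int_sq Q h.aeQ _ _ (moments h).1.2 (moments h).2.2 r q

lemma dd_le {α : Set ℝ} {a : ℝ} (ha : a ∈ α) (x : ℝ) : dd α x ≤ (x - a)^2 :=
  ciInf_le (f := fun a : α => (x - (a:ℝ))^2)
    ⟨0, by rintro _ ⟨b, rfl⟩; exact sq_nonneg _⟩ ⟨a, ha⟩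

lemma dd_exists {α : Set ℝ} (hf : α.Finite) (hne : α.Nonempty) (x : ℝ) :
    ∃ a ∈ α, dd α x = (x - a)^2 ∧ ∀ b ∈ α, (x - a)^2 ≤ (x - b)^2 := by
  obtain ⟨a, ha, h⟩ := Set.exists_min_image α (fun a => (x - a)^2) hf hne
  refine ⟨a, ha, le_antisymm (dd_le ha x) ?_, h⟩
  have := hne.to_subtype
  exact le_ciInf fun b => h b b.2

lemma dd_nonneg (α : Set ℝ) (x : ℝ) : 0 ≤ dd α x :=
  Real.iInf_nonneg fun _ => sq_nonneg _

lemma dd_cont {α : Set ℝ} (hf : α.Finite) (hne : α.Nonempty) : Continuous (dd α) := by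
  have : dd α = fun x => (Metric.infDist x α)^2 := by
    ext x
    obtain ⟨a, ha, h1, h2⟩ := dd_exists hf hne x
    obtain ⟨b, hb, h3⟩ := hf.isCompact.exists_infDist_eq_dist hne x
    rw [h3, Real.dist_eq, sq_abs, h1]
    apply le_antisymm (h2 b hb)
    have := Metric.infDist_le_dist_of_mem (x := x) ha
    rw [h3, Real.dist_eq, Real.dist_eq] at this
    exact sq_le_sq.2 this
  rw [this]
  exact (Metric.continuous_infDist_pt α).pow 2

/-- integral of the squared distance over an affine image -/
def II (μ : Measure ℝ) (α : Set ℝ) (q r : ℝ) : ℝ := ∫ x, dd α (q + r * x) ∂μ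

/-- lower bounds -/
lemma lowP {P Q : Measure ℝ} (h : Sys P Q) {α : Set ℝ} (hf : α.Finite) (hne : α.Nonempty)
    (r q t : ℝ) (hb : ∀ x, 0 ≤ x → x ≤ 1 → (q + r * x - t)^2 ≤ dd α (q + r * x)) :
    r^2 * (288/3577) + (q + r * (4/7) - t)^2 ≤ II P α q r := by
  unfold II
  have := h.probP
  have e := sqP h r (q - t)
  have : r^2 * (288/3577) + (q + r * (4/7) - t)^2 = ∫ x, (q - t + r * x)^2 ∂P := by rw [e]; ring
  rw [this]
  refine integral_mono_ae (intg P h.aeP _ (by fun_prop))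
    (intg P h.aeP _ ((dd_cont hf hne).comp (by fun_prop))) ?_
  filter_upwards [h.aeP] with x hx
  have h1 := hb x hx.1 hx.2
  have h2 : (q - t + r * x)^2 = (q + r * x - t)^2 := by ring
  change (q - t + r * x)^2 ≤ dd α (q + r * x)
  rw [h2]; exact h1

lemma lowQ {P Q : Measure ℝ} (h : Sys P Q) {α : Set ℝ} (hf : α.Finite) (hne : α.Nonempty)
    (r q t : ℝ) (hb : ∀ x, 0 ≤ x → x ≤ 1 → (q + r * x - t)^2 ≤ dd α (q + r * x)) :
    r^2 * (344/3577) + (q + r * (3/7) - t)^2 ≤ II Q α q r := by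
  unfold II
  have := h.probQ
  have e := sqQ h r (q - t)
  have : r^2 * (344/3577) + (q + r * (3/7) - t)^2 = ∫ x, (q - t + r * x)^2 ∂Q := by rw [e]; ring
  rw [this]
  refine integral_mono_ae (intg Q h.aeQ _ (by fun_prop))
    (intg Q h.aeQ _ ((dd_cont hf hne).comp (by fun_prop))) ?_
  filter_upwards [h.aeQ] with x hx
  have h1 := hb x hx.1 hx.2
  have h2 : (q - t + r * x)^2 = (q + r * x - t)^2 := by ring
  change (q - t + r * x)^2 ≤ dd α (q + r * x)
  rw [h2]; exact h1

lemma sqA {a t y : ℝ} (h1 : a ≤ t) (h2 : a + t ≤ 2 * y) : (y - t)^2 ≤ (y - a)^2 := by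
  nlinarith [mul_nonneg (sub_nonneg.2 h1) (sub_nonneg.2 h2)]

lemma sqB {a t y : ℝ} (h1 : t ≤ a) (h2 : 2 * y ≤ a + t) : (y - t)^2 ≤ (y - a)^2 := by
  nlinarith [mul_nonneg (sub_nonneg.2 h1) (sub_nonneg.2 h2)]

/-- non-splitting at the point `c` -/
def NS (α : Set ℝ) (c : ℝ) : Prop :=
  c ∈ α ∧ ∀ a ∈ α, a = c ∨ (a < c ∧ a + c < 1/2) ∨ (c < a ∧ 1 < a + c)

lemma ns_right {α : Set ℝ} (hf : α.Finite) {c : ℝ} (hns : NS α c) {y : ℝ} (hy : 1/4 ≤ y) :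
    ∃ a ∈ α, dd α y = (y - a)^2 ∧ (a = c ∨ (c < a ∧ 1 < a + c)) := by
  obtain ⟨a, ha, h1, h2⟩ := dd_exists hf ⟨c, hns.1⟩ y
  refine ⟨a, ha, h1, ?_⟩
  rcases hns.2 a ha with h | h | h
  · exact Or.inl h
  · exfalso
    have := h2 c hns.1
    nlinarith [mul_pos (sub_pos.2 h.1) (show 0 < 2 * y - (a + c) by linarith)]
  · exact Or.inr h

lemma ns_left {α : Set ℝ} (hf : α.Finite) {c : ℝ} (hns : NS α c) {y : ℝ} (hy : y ≤ 1/2) :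
    ∃ a ∈ α, dd α y = (y - a)^2 ∧ (a = c ∨ (a < c ∧ a + c < 1/2)) := by
  obtain ⟨a, ha, h1, h2⟩ := dd_exists hf ⟨c, hns.1⟩ y
  refine ⟨a, ha, h1, ?_⟩
  rcases hns.2 a ha with h | h | h
  · exact Or.inl h
  · exact Or.inr h
  · exfalso
    have := h2 c hns.1
    nlinarith [mul_pos (sub_pos.2 h.1) (show 0 < (a + c) - 2 * y by linarith)]

lemma hL {α : Set ℝ} (hf : α.Finite) {c : ℝ} (hns : NS α c) {y : ℝ} (hc : 1/4 ≤ c)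
    (h1 : 1/2 - c ≤ y) (h2 : y ≤ 1/4) : (y - (1/2 - c))^2 ≤ dd α y := by
  obtain ⟨a, ha, h, h'⟩ := ns_left hf hns (y := y) (by linarith)
  rw [h]
  rcases h' with rfl | h'
  · exact sqB (by linarith) (by linarith)
  · exact sqA (by linarith) (by linarith)

lemma hR {α : Set ℝ} (hf : α.Finite) {c : ℝ} (hns : NS α c) {y : ℝ} (hc : c ≤ 1/2)
    (h1 : 1/2 ≤ y) (h2 : y ≤ 1 - c) : (y - (1 - c))^2 ≤ dd α y := by
  obtain ⟨a, ha, h, h'⟩ := ns_right hf hns (y := y) (by linarith)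
  rw [h]
  rcases h' with rfl | h'
  · exact sqA (by linarith) (by linarith)
  · exact sqB (by linarith) (by linarith)

lemma hpt {α : Set ℝ} (hf : α.Finite) {c d : ℝ} (hns : NS α c) (hd : ∀ a ∈ α, c < a → a = d)
    {y t : ℝ} (h1 : 1/4 ≤ y) (h2 : c ≤ t) (h3 : c + t ≤ 2 * y) (h4 : t = d ∨ (t ≤ d ∧ 2 * y ≤ t + d)) :
    (y - t)^2 ≤ dd α y := by
  obtain ⟨a, ha, h, h'⟩ := ns_right hf hns h1
  rw [h]
  rcases h' with rfl | h'
  · exact sqA (by linarith) (by linarith)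
  · have := hd a ha h'.1
    subst this
    rcases h4 with rfl | h4
    · exact le_rfl
    · exact sqB (by linarith) (by linarith)

lemma splitP {P Q : Measure ℝ} (h : Sys P Q) {α : Set ℝ} (hf : α.Finite) (hne : α.Nonempty) (q r : ℝ) :
    II P α (q) (r) = 1/4 * II P α (q) ((r/4))
      + 3/4 * II Q α (q + r/2) ((r/2)) := by
  unfold II
  rw [h.eqP (fun x => dd α (q + r * x)) ((dd_cont hf hne).comp (by fun_prop))]
  congr 4 <;> ext x <;> simp only [fL, gR] <;> congr 1 <;> ring

lemma splitQ {P Q : Measure ℝ} (h : Sys P Q) {α : Set ℝ} (hf : α.Finite) (hne : α.Nonempty) (q r : ℝ) :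
    II Q α (q) (r) = 1/2 * II P α (q) ((r/4))
      + 1/2 * II Q α (q + r/2) ((r/2)) := by
  unfold II
  rw [h.eqQ (fun x => dd α (q + r * x)) ((dd_cont hf hne).comp (by fun_prop))]
  congr 4 <;> ext x <;> simp only [fL, gR] <;> congr 1 <;> ring

lemma pieces {P Q : Measure ℝ} (h : Sys P Q) {α : Set ℝ} (hf : α.Finite) (hne : α.Nonempty) :
    (3/4 * II Q α (1/8) (1/8) ≤ II P α (0) (1/4)) ∧
    (1/2 * II Q α (3/16) (1/16) ≤ II Q α (1/8) (1/8)) ∧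
    (II Q α (1/2) (1/2) = 1/2 * II P α (1/2) (1/8)
        + 1/2 * II Q α (3/4) (1/4)) ∧
    (II P α (1/2) (1/8) = 1/4 * II P α (1/2) (1/32)
        + 3/4 * II Q α (9/16) (1/16)) ∧
    (II Q α (9/16) (1/16) = 1/2 * II P α (9/16) (1/64)
        + 1/2 * II Q α (19/32) (1/32)) := by
  have nP : ∀ q r : ℝ, 0 ≤ II P α (q) (r) :=
    fun q r => integral_nonneg fun x => dd_nonneg _ _
  have nQ : ∀ q r : ℝ, 0 ≤ II Q α (q) (r) :=
    fun q r => integral_nonneg fun x => dd_nonneg _ _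
  refine ⟨?_, ?_, ?_, ?_, ?_⟩
  · have e := splitP h hf hne 0 (1/4)
    have e' := nP 0 (1/4/4)
    norm_num at e e' ⊢
    linarith
  · have e := splitQ h hf hne (1/8) (1/8)
    have e' := nP (1/8) (1/8/4)
    norm_num at e e' ⊢
    linarith
  · have e := splitQ h hf hne (1/2) (1/2)
    norm_num at e ⊢
    linarith
  · have e := splitP h hf hne (1/2) (1/8)
    norm_num at e ⊢
    linarith
  · have e := splitQ h hf hne (9/16) (1/16)
    norm_num at e ⊢
    linarith

lemma low_nonneg (μ : Measure ℝ) (α : Set ℝ) (q r : ℝ) : 0 ≤ II μ α (q) (r) :=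
  integral_nonneg fun _ => dd_nonneg _ _

set_option maxHeartbeats 4000000 in
lemma bound4 {P Q : Measure ℝ} (h : Sys P Q) {α : Set ℝ} (hf : α.Finite) {c : ℝ} (hns : NS α c) :
    (7.40625/3577 < 1/4 * II P α (0) (1/4) + 3/8 * II P α (1/2) (1/8)) ∧
    (8.65625/3577 < 1/2 * II P α (0) (1/4) + 1/4 * II P α (1/2) (1/8)) := by
  have hne : α.Nonempty := ⟨c, hns.1⟩
  obtain ⟨p1, p2, p3, p4, p5⟩ := pieces h hf hne
  have n1 := low_nonneg P α 0 (1/4)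
  have n2 := low_nonneg P α (1/2) (1/8)
  have n3 := low_nonneg Q α (19/32) (1/32)
  have n4 := low_nonneg P α (1/2) (1/32)
  have n5 := low_nonneg P α (9/16) (1/64)
  rcases le_total c (5/16) with c1 | c1
  · have b := lowP h hf hne (1/8) (1/2) (1 - c)
      (fun x h0 h1 => hR hf hns (by linarith) (by linarith) (by linarith))
    have : (13/112)^2 ≤ (1/2 + 1/8 * (4/7) - (1-c))^2 := by nlinarith
    constructor <;> norm_num at * <;> linarith
  rcases le_total c (3/8) with c2 | c2
  · have b := lowP h hf hne (1/8) (1/2) (1 - c)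
      (fun x h0 h1 => hR hf hns (by linarith) (by linarith) (by linarith))
    have b' := lowQ h hf hne (1/16) (3/16) (1/2 - c)
      (fun x h0 h1 => hL hf hns (by linarith) (by linarith) (by linarith))
    constructor
    · nlinarith [sq_nonneg (c - 0.4)]
    · nlinarith [sq_nonneg (c - 0.367)]
  rcases le_total c (27/64) with c3 | c3
  · have b := lowQ h hf hne (1/8) (1/8) (1/2 - c)
      (fun x h0 h1 => hL hf hns (by linarith) (by linarith) (by linarith))
    have b1 := lowP h hf hne (1/32) (1/2) (1 - c)
      (fun x h0 h1 => hR hf hns (by linarith) (by linarith) (by linarith))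
    have b2 := lowP h hf hne (1/64) (9/16) (1 - c)
      (fun x h0 h1 => hR hf hns (by linarith) (by linarith) (by linarith))
    constructor
    · nlinarith [sq_nonneg (c - 0.389)]
    · nlinarith [sq_nonneg (c - 0.365)]
  · have b := lowQ h hf hne (1/8) (1/8) (1/2 - c)
      (fun x h0 h1 => hL hf hns (by linarith) (by linarith) (by linarith))
    constructor <;> nlinarith

lemma boundT {P Q : Measure ℝ} (h : Sys P Q) {α : Set ℝ} (hf : α.Finite) {c d : ℝ} (hns : NS α c)
    (hd : ∀ a ∈ α, c < a → a = d) (hcd : c < d) (hc : c ≤ 1/2) :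
    (1/4)^2 * (344/3577) + (3/4 + 1/4 * (3/7) - min d 1)^2 ≤ II Q α (3/4) (1/4) := by
  refine lowQ h hf ⟨c, hns.1⟩ (1/4) (3/4) (min d 1) fun x h0 h1 => ?_
  rcases le_total d 1 with hd1 | hd1
  · rw [min_eq_left hd1]
    exact hpt hf hns hd (by linarith) hcd.le (by linarith) (Or.inl rfl)
  · rw [min_eq_right hd1]
    exact hpt hf hns hd (by linarith) (by linarith) (by linarith) (Or.inr ⟨hd1, by linarith⟩)

lemma boundNoLeft {P Q : Measure ℝ} (h : Sys P Q) {α : Set ℝ} (hf : α.Finite) {c : ℝ} (hns : NS α c)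
    (hl : ∀ a ∈ α, ¬ a < c) :
    (1/4)^2 * (288/3577) + (0 + 1/4 * (4/7) - c)^2 ≤ II P α (0) (1/4) := by
  refine lowP h hf ⟨c, hns.1⟩ (1/4) 0 c fun x h0 h1 => ?_
  obtain ⟨a, ha, e, h'⟩ := ns_left hf hns (y := 0 + 1/4 * x) (by linarith)
  rw [e]
  rcases h' with rfl | h'
  · exact le_rfl
  · exact absurd h'.1 (hl a ha)

lemma boundNoRight {P Q : Measure ℝ} (h : Sys P Q) {α : Set ℝ} (hf : α.Finite) {c : ℝ} (hns : NS α c)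
    (hl : ∀ a ∈ α, ¬ c < a) :
    (1/2)^2 * (344/3577) + (1/2 + 1/2 * (3/7) - c)^2 ≤ II Q α (1/2) (1/2) := by
  refine lowQ h hf ⟨c, hns.1⟩ (1/2) (1/2) c fun x h0 h1 => ?_
  obtain ⟨a, ha, e, h'⟩ := ns_right hf hns (y := 1/2 + 1/2 * x) (by linarith)
  rw [e]
  rcases h' with rfl | h'
  · exact le_rfl
  · exact absurd h'.1 (hl a ha)

set_option maxHeartbeats 4000000 in
lemma bound3 {P Q : Measure ℝ} (h : Sys P Q) {α : Set ℝ} (hf : α.Finite) {c : ℝ} (hns : NS α c)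
    (hcard : α.ncard = 3) :
    (14.25/3577 < 1/4 * II P α (0) (1/4) + 3/4 * II Q α (1/2) (1/2)) ∧
    (15.5/3577 < 1/2 * II P α (0) (1/4) + 1/2 * II Q α (1/2) (1/2)) := by
  have hne : α.Nonempty := ⟨c, hns.1⟩
  have B4 := bound4 h hf hns
  obtain ⟨p1, p2, p3, p4, p5⟩ := pieces h hf hne
  have n1 := low_nonneg P α 0 (1/4)
  have n2 := low_nonneg P α (1/2) (1/8)
  have n3 := low_nonneg Q α (19/32) (1/32)
  have n4 := low_nonneg P α (1/2) (1/32)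
  have n5 := low_nonneg P α (9/16) (1/64)
  have n6 := low_nonneg Q α (3/4) (1/4)
  rcases le_total c (1/4) with c1 | c1
  · have b := lowP h hf hne (1/8) (1/2) (1 - c)
      (fun x h0 h1 => hR hf hns (by linarith) (by linarith) (by linarith))
    constructor <;> nlinarith
  by_cases hr : ∃ d ∈ α, c < d
  swap
  · push Not at hr
    have b := boundNoRight h hf hns (fun a ha => not_lt.2 (hr a ha))
    have := sq_nonneg (1/2 + 1/2 * (3/7) - c)
    constructor <;> nlinarith
  by_cases hl : ∃ b ∈ α, b < c
  swap
  · push Not at hl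
    have b := boundNoLeft h hf hns (fun a ha => not_lt.2 (hl a ha))
    have : (3/28)^2 ≤ (0 + 1/4 * (4/7) - c)^2 := by nlinarith
    have n7 := low_nonneg Q α (1/2) (1/2)
    constructor <;> nlinarith
  obtain ⟨d, hd, hcd⟩ := hr
  obtain ⟨b, hb, hbc⟩ := hl
  have hα : ∀ a ∈ α, c < a → a = d := by
    intro a ha hca
    by_contra hne'
    have hs : ({b, c, d, a} : Finset ℝ).card = 4 := by
      rw [Finset.card_insert_of_notMem, Finset.card_insert_of_notMem, Finset.card_insert_of_notMem,
        Finset.card_singleton]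
      · simpa using fun h => hne' h.symm
      · simp; exact ⟨hcd.ne, hca.ne⟩
      · simp; exact ⟨hbc.ne, (hbc.trans hcd).ne, (hbc.trans hca).ne⟩
    have hsub : (({b, c, d, a} : Finset ℝ) : Set ℝ) ⊆ α := by
      intro z hz
      simp at hz
      rcases hz with rfl | rfl | rfl | rfl
      exacts [hb, hns.1, hd, ha]
    have := Set.ncard_le_ncard hsub hf
    rw [Set.ncard_coe_finset, hs, hcard] at this
    omega
  have hcd1 : 1 < d + c := by
    rcases hns.2 d hd with h | h | h
    · linarith
    · linarith
    · exact h.2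
  rcases le_total (1/2) c with c2 | c2
  · have b := lowP h hf hne (1/4) 0 (1/2 - c)
      (fun x h0 h1 => hL hf hns (by linarith) (by linarith) (by linarith))
    have : (1/7)^2 ≤ (0 + 1/4 * (4/7) - (1/2 - c))^2 := by nlinarith
    constructor <;> nlinarith
  have bT := boundT h hf hns hα hcd c2
  have sT := sq_nonneg (3/4 + 1/4 * (3/7) - min d 1)
  constructor
  · linarith [B4.1]
  rcases le_total (7/16) c with c3 | c3
  · have b := lowQ h hf hne (1/8) (1/8) (1/2 - c)
      (fun x h0 h1 => hL hf hns (by linarith) (by linarith) (by linarith))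
    nlinarith
  rcases le_total (min d 1) (3/4) with c4 | c4
  · have : (3/28)^2 ≤ (3/4 + 1/4 * (3/7) - min d 1)^2 := by nlinarith
    linarith
  · have c5 : 3/4 ≤ d := c4.trans (min_le_left _ _)
    have b1 := lowP h hf hne (1/64) (9/16) (7/16)
      (fun x h0 h1 => hpt hf hns hα (by linarith) (by linarith) (by linarith)
        (Or.inr ⟨by linarith, by linarith⟩))
    have b2 := lowQ h hf hne (1/32) (19/32) (3/4)
      (fun x h0 h1 => hpt hf hns hα (by linarith) (by linarith) (by linarith)
        (Or.inr ⟨by linarith, by linarith⟩))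
    norm_num at *
    linarith

set_option maxHeartbeats 4000000 in
lemma bound2 {P Q : Measure ℝ} (h : Sys P Q) {α : Set ℝ} (hf : α.Finite) {c : ℝ} (hns : NS α c)
    (hcard : α.ncard = 2) :
    (69/3577 < 1/4 * II P α (0) (1/4) + 3/4 * II Q α (1/2) (1/2)) ∧
    (52/3577 < 1/2 * II P α (0) (1/4) + 1/2 * II Q α (1/2) (1/2)) := by
  have hne : α.Nonempty := ⟨c, hns.1⟩
  obtain ⟨p1, p2, p3, p4, p5⟩ := pieces h hf hne
  have n1 := low_nonneg P α 0 (1/4)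
  have n2 := low_nonneg P α (1/2) (1/8)
  have n3 := low_nonneg Q α (19/32) (1/32)
  have n4 := low_nonneg P α (1/2) (1/32)
  have n5 := low_nonneg P α (9/16) (1/64)
  have n6 := low_nonneg Q α (3/4) (1/4)
  have n7 := low_nonneg Q α (1/2) (1/2)
  have key : ∀ a ∈ α, ∀ b ∈ α, a ≠ c → b ≠ c → a = b := by
    intro a ha b hb hac hbc
    by_contra hab
    have hs : ({a, b, c} : Finset ℝ).card = 3 := by
      rw [Finset.card_insert_of_notMem, Finset.card_insert_of_notMem, Finset.card_singleton]
      · simpa using hbc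
      · simp; exact ⟨hab, hac⟩
    have hsub : (({a, b, c} : Finset ℝ) : Set ℝ) ⊆ α := by
      intro z hz
      simp at hz
      rcases hz with rfl | rfl | rfl
      exacts [ha, hb, hns.1]
    have := Set.ncard_le_ncard hsub hf
    rw [Set.ncard_coe_finset, hs, hcard] at this
    omega
  by_cases hr : ∃ d ∈ α, c < d
  swap
  · push Not at hr
    have b := boundNoRight h hf hns (fun a ha => not_lt.2 (hr a ha))
    rcases le_total c (1/2) with c1 | c1
    · constructor <;> nlinarith
    · have b' := lowP h hf hne (1/4) 0 (1/2 - c)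
        (fun x h0 h1 => hL hf hns (by linarith) (by linarith) (by linarith))
      have : (1/7)^2 ≤ (0 + 1/4 * (4/7) - (1/2 - c))^2 := by nlinarith
      have := sq_nonneg (1/2 + 1/2 * (3/7) - c)
      constructor <;> linarith
  obtain ⟨d, hd, hcd⟩ := hr
  have hα : ∀ a ∈ α, c < a → a = d := fun a ha hca => key a ha d hd hca.ne' hcd.ne'
  have bA := boundNoLeft h hf hns (fun a ha hac => by
    have := key a ha d hd hac.ne hcd.ne'
    linarith)
  have hcd1 : 1 < d + c := by
    rcases hns.2 d hd with h | h | h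
    · linarith
    · linarith
    · exact h.2
  rcases le_total (7/16) c with c1 | c1
  · have : (33/112)^2 ≤ (0 + 1/4 * (4/7) - c)^2 := by nlinarith
    constructor <;> linarith
  have bT := boundT h hf hns hα hcd (by linarith)
  obtain ⟨e, he⟩ : ∃ e, e = min d 1 := ⟨_, rfl⟩
  rw [← he] at bT
  have he1 : e ≤ d := he ▸ min_le_left _ _
  have he2 : e ≤ 1 := he ▸ min_le_right _ _
  have he3 : e = d ∨ e = 1 := by
    rw [he]; exact (min_choice d 1)
  have he4 : c ≤ e := by rcases he3 with h | h <;> linarith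
  have bJ2 : e ≤ 9/8 - c → (1/16)^2 * (344/3577) + (9/16 + 1/16 * (3/7) - e)^2
      ≤ II Q α (9/16) (1/16) := by
    intro h5
    refine lowQ h hf hne (1/16) (9/16) e
      (fun x h0 h1 => hpt hf hns hα (by linarith) he4 (by linarith) ?_)
    rcases he3 with h6 | h6
    · exact Or.inl h6
    · exact Or.inr ⟨he1, by linarith⟩
  have sT := sq_nonneg (3/4 + 1/4 * (3/7) - e)
  have sA := sq_nonneg (0 + 1/4 * (4/7) - c)
  rcases le_total (3/8) c with c2 | c2
  · have s1 : (13/56)^2 ≤ (0 + 1/4 * (4/7) - c)^2 := by nlinarith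
    rcases le_total e (3/4) with c4 | c4
    · have : (3/28)^2 ≤ (3/4 + 1/4 * (3/7) - e)^2 := by nlinarith
      constructor <;> linarith
    · have b1 := lowP h hf hne (1/64) (9/16) (7/16)
        (fun x h0 h1 => hpt hf hns hα (by linarith) (by linarith) (by linarith)
          (Or.inr ⟨by linarith, by linarith⟩))
      have b2 := lowQ h hf hne (1/32) (19/32) (3/4)
        (fun x h0 h1 => hpt hf hns hα (by linarith) (by linarith) (by linarith)
          (Or.inr ⟨by linarith, by linarith⟩))
      constructor <;> nlinarith
  rcases le_total (5/16) c with c3 | c3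
  · have s1 : (19/112)^2 ≤ (0 + 1/4 * (4/7) - c)^2 := by nlinarith
    constructor
    swap
    · linarith
    rcases le_total e (3/4) with c4 | c4
    · have b1 := bJ2 (by linarith)
      nlinarith [sq_nonneg (e - 0.7424)]
    · have b1 := lowP h hf hne (1/32) (1/2) (3/8)
        (fun x h0 h1 => hpt hf hns hα (by linarith) (by linarith) (by linarith)
          (Or.inr ⟨by linarith, by linarith⟩))
      have b2 := lowQ h hf hne (1/16) (9/16) (3/4)
        (fun x h0 h1 => hpt hf hns hα (by linarith) (by linarith) (by linarith)
          (Or.inr ⟨by linarith, by linarith⟩))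
      nlinarith
  have b3 : 13/16 ≤ e → _ := fun he5 => lowQ h hf hne (1/16) (9/16) (13/16)
        (fun x h0 h1 => hpt hf hns hα (by linarith) (by linarith) (by linarith)
          (Or.inr ⟨by linarith, by linarith⟩))
  rcases le_total (1/4) c with c4 | c4
  · have s1 : (3/28)^2 ≤ (0 + 1/4 * (4/7) - c)^2 := by nlinarith
    have b1 := lowP h hf hne (1/32) (1/2) (11/16)
        (fun x h0 h1 => hpt hf hns hα (by linarith) (by linarith) (by linarith)
          (Or.inr ⟨by linarith, by linarith⟩))
    rcases le_total e (13/16) with c5 | c5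
    · have b2 := bJ2 (by linarith)
      constructor <;> nlinarith [sq_nonneg (e - 0.7424)]
    · have b2 := b3 c5
      constructor <;> nlinarith
  · have b1 := lowP h hf hne (1/32) (1/2) (3/4)
        (fun x h0 h1 => hpt hf hns hα (by linarith) (by linarith) (by linarith)
          (Or.inr ⟨by linarith, by linarith⟩))
    have he5 : 3/4 ≤ e := by rcases he3 with h | h <;> linarith
    rcases le_total e (13/16) with c5 | c5
    · have b2 := bJ2 (by linarith)
      constructor <;> nlinarith [sq_nonneg (e - 0.7424)]
    · have b2 := b3 c5
      constructor <;> nlinarith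

structure Ty (P Q ρ : Measure ℝ) (w m v : ℝ) : Prop where
  prob : IsProbabilityMeasure ρ
  ae : ∀ᵐ x ∂ρ, x ∈ Set.Icc (0:ℝ) 1
  w0 : 0 < w
  w1 : w < 1
  eq : ∀ h : ℝ → ℝ, Continuous h →
    ∫ x, h x ∂ρ = w * ∫ x, h (fL x) ∂P + (1 - w) * ∫ x, h (gR x) ∂Q
  sq : ∀ t : ℝ, ∫ x, (x - t)^2 ∂ρ = v + (m - t)^2

lemma tyP {P Q : Measure ℝ} (h : Sys P Q) : Ty P Q P (1/4) (4/7) (288/3577) where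
  prob := h.probP
  ae := h.aeP
  w0 := by norm_num
  w1 := by norm_num
  eq := fun k hk => by rw [h.eqP k hk]; norm_num
  sq := fun t => by
    have := sqP h 1 (-t)
    have e : ∀ x : ℝ, (x - t)^2 = (-t + 1 * x)^2 := fun x => by ring
    simp_rw [e]; rw [this]; ring

lemma tyQ {P Q : Measure ℝ} (h : Sys P Q) : Ty P Q Q (1/2) (3/7) (344/3577) where
  prob := h.probQ
  ae := h.aeQ
  w0 := by norm_num
  w1 := by norm_num
  eq := fun k hk => by rw [h.eqQ k hk]; norm_num
  sq := fun t => by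
    have := sqQ h 1 (-t)
    have e : ∀ x : ℝ, (x - t)^2 = (-t + 1 * x)^2 := fun x => by ring
    simp_rw [e]; rw [this]; ring

lemma dd_fL_le {α β : Set ℝ} (hf : β.Finite) (hne : β.Nonempty) (hs : ∀ b ∈ β, fL b ∈ α) (x : ℝ) :
    dd α (fL x) ≤ 1/16 * dd β x := by
  obtain ⟨b, hb, h1, -⟩ := dd_exists hf hne x
  rw [h1]
  refine (dd_le (hs b hb) _).trans (le_of_eq ?_)
  simp only [fL]; ring

lemma dd_gR_le {α β : Set ℝ} (hf : β.Finite) (hne : β.Nonempty) (hs : ∀ b ∈ β, gR b ∈ α) (x : ℝ) :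
    dd α (gR x) ≤ 1/4 * dd β x := by
  obtain ⟨b, hb, h1, -⟩ := dd_exists hf hne x
  rw [h1]
  refine (dd_le (hs b hb) _).trans (le_of_eq ?_)
  simp only [gR]; ring

lemma merge {P Q ρ : Measure ℝ} {w m v : ℝ} (h : Sys P Q) (ht : Ty P Q ρ w m v)
    {β γ : Set ℝ} (hβ : β.Finite) (hβn : β.Nonempty) (hγ : γ.Finite) (hγn : γ.Nonempty) :
    ∫ x, dd (fL '' β ∪ gR '' γ) x ∂ρ ≤ w/16 * ∫ x, dd β x ∂P + (1-w)/4 * ∫ x, dd γ x ∂Q := by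
  have := h.probP
  have := h.probQ
  have hfin : (fL '' β ∪ gR '' γ).Finite := (hβ.image _).union (hγ.image _)
  have hnon : (fL '' β ∪ gR '' γ).Nonempty := (hβn.image _).inl
  have hc := dd_cont hfin hnon
  rw [ht.eq _ hc]
  have e1 : ∫ x, dd (fL '' β ∪ gR '' γ) (fL x) ∂P ≤ ∫ x, 1/16 * dd β x ∂P :=
    integral_mono (intg P h.aeP _ (hc.comp fL_cont))
      (intg P h.aeP _ (continuous_const.mul (dd_cont hβ hβn)))
      (fun x => dd_fL_le hβ hβn (fun b hb => Or.inl ⟨b, hb, rfl⟩) x)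
  have e2 : ∫ x, dd (fL '' β ∪ gR '' γ) (gR x) ∂Q ≤ ∫ x, 1/4 * dd γ x ∂Q :=
    integral_mono (intg Q h.aeQ _ (hc.comp gR_cont))
      (intg Q h.aeQ _ (continuous_const.mul (dd_cont hγ hγn)))
      (fun x => dd_gR_le hγ hγn (fun b hb => Or.inr ⟨b, hb, rfl⟩) x)
  rw [integral_const_mul] at e1 e2
  have := ht.w0
  have := ht.w1
  nlinarith [mul_le_mul_of_nonneg_left e1 ht.w0.le,
    mul_le_mul_of_nonneg_left e2 (sub_nonneg.2 ht.w1.le)]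

lemma card_merge {β γ : Set ℝ} : (fL '' β ∪ gR '' γ).ncard ≤ β.ncard + γ.ncard := by
  have i1 : Function.Injective fL := fun x y h => by simp only [fL] at h; linarith
  have i2 : Function.Injective gR := fun x y h => by simp only [gR] at h; linarith
  refine (Set.ncard_union_le _ _).trans ?_
  rw [Set.ncard_image_of_injective _ i1, Set.ncard_image_of_injective _ i2]

/-- existence of a set of at most `n` points with small error -/
def Up (ρ : Measure ℝ) (n : ℕ) (u : ℝ) : Prop :=
  ∃ γ : Set ℝ, γ.Finite ∧ γ.Nonempty ∧ γ.ncard ≤ n ∧ ∫ x, dd γ x ∂ρ ≤ u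

lemma dd_single (a x : ℝ) : dd {a} x = (x - a)^2 := by
  obtain ⟨b, hb, h, -⟩ := dd_exists (Set.finite_singleton a) ⟨a, rfl⟩ x
  rw [h, Set.mem_singleton_iff.1 hb]

lemma up_one {P Q ρ : Measure ℝ} {w m v : ℝ} (ht : Ty P Q ρ w m v) : Up ρ 1 v := by
  refine ⟨{m}, Set.finite_singleton _, ⟨m, rfl⟩, by simp, ?_⟩
  simp_rw [dd_single]
  rw [ht.sq]; simp

lemma up_merge {P Q ρ : Measure ℝ} {w m v : ℝ} (h : Sys P Q) (ht : Ty P Q ρ w m v)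
    {k l : ℕ} {u u' : ℝ} (h1 : Up P k u) (h2 : Up Q l u') :
    Up ρ (k + l) (w/16 * u + (1-w)/4 * u') := by
  obtain ⟨β, b1, b2, b3, b4⟩ := h1
  obtain ⟨γ, c1, c2, c3, c4⟩ := h2
  refine ⟨fL '' β ∪ gR '' γ, (b1.image _).union (c1.image _), (b2.image _).inl,
    card_merge.trans (by omega), (merge h ht b1 b2 c1 c2).trans ?_⟩
  have := ht.w0
  have := ht.w1
  gcongr

def Opt (ρ : Measure ℝ) (α : Set ℝ) : Prop :=
  α.Finite ∧ α.Nonempty ∧ ∀ β : Set ℝ, β.Finite → β.Nonempty → β.ncard ≤ α.ncard →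
    ∫ x, dd α x ∂ρ ≤ ∫ x, dd β x ∂ρ

lemma opt_up {ρ : Measure ℝ} {α : Set ℝ} (h : Opt ρ α) {n : ℕ} {u : ℝ} (hu : Up ρ n u)
    (hn : n ≤ α.ncard) : ∫ x, dd α x ∂ρ ≤ u := by
  obtain ⟨γ, h1, h2, h3, h4⟩ := hu
  exact (h.2.2 γ h1 h2 (h3.trans hn)).trans h4

lemma ups {P Q : Measure ℝ} (h : Sys P Q) :
    (Up P 2 (69/3577) ∧ Up Q 2 (52/3577)) ∧ (Up P 3 (14.25/3577) ∧ Up Q 3 (15.5/3577)) ∧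
      (Up P 4 (7.40625/3577) ∧ Up Q 4 (8.65625/3577)) := by
  have a1 := up_one (tyP h)
  have b1 := up_one (tyQ h)
  have a2 : Up P 2 (69/3577) := by
    convert up_merge h (tyP h) a1 b1 using 1; norm_num
  have b2 : Up Q 2 (52/3577) := by
    convert up_merge h (tyQ h) a1 b1 using 1; norm_num
  have a3 : Up P 3 (14.25/3577) := by
    convert up_merge h (tyP h) a1 b2 using 1; norm_num
  have b3 : Up Q 3 (15.5/3577) := by
    convert up_merge h (tyQ h) a1 b2 using 1; norm_num
  have a4 : Up P 4 (7.40625/3577) := by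
    convert up_merge h (tyP h) a1 b3 using 1; norm_num
  have b4 : Up Q 4 (8.65625/3577) := by
    convert up_merge h (tyQ h) a2 b2 using 1; norm_num
  exact ⟨⟨a2, b2⟩, ⟨a3, b3⟩, a4, b4⟩

lemma eq_II {P Q ρ : Measure ℝ} {w m v : ℝ} (ht : Ty P Q ρ w m v) {α : Set ℝ} (hf : α.Finite)
    (hne : α.Nonempty) :
    ∫ x, dd α x ∂ρ = w * II P α 0 (1/4) + (1 - w) * II Q α (1/2) (1/2) := by
  rw [ht.eq _ (dd_cont hf hne)]
  unfold II
  congr 4 <;> ext x <;> simp only [fL, gR] <;> congr 1 <;> ring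

lemma no_NS {P Q : Measure ℝ} (h : Sys P Q) {α : Set ℝ} (h2 : 2 ≤ α.ncard) {c : ℝ} (hns : NS α c) :
    ¬ Opt P α ∧ ¬ Opt Q α := by
  obtain ⟨⟨u2, v2⟩, ⟨u3, v3⟩, ⟨u4, v4⟩⟩ := ups h
  by_cases c2 : α.ncard = 2
  · constructor <;> intro ho
    · have e := eq_II (tyP h) ho.1 ho.2.1
      have := opt_up ho u2 (by omega)
      have := (bound2 h ho.1 hns c2).1
      linarith
    · have e := eq_II (tyQ h) ho.1 ho.2.1
      have := opt_up ho v2 (by omega)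
      have := (bound2 h ho.1 hns c2).2
      linarith
  by_cases c3 : α.ncard = 3
  · constructor <;> intro ho
    · have e := eq_II (tyP h) ho.1 ho.2.1
      have := opt_up ho u3 (by omega)
      have := (bound3 h ho.1 hns c3).1
      linarith
    · have e := eq_II (tyQ h) ho.1 ho.2.1
      have := opt_up ho v3 (by omega)
      have := (bound3 h ho.1 hns c3).2
      linarith
  · constructor <;> intro ho
    · have e := eq_II (tyP h) ho.1 ho.2.1
      have := opt_up ho u4 (by omega)
      have := (bound4 h ho.1 hns).1
      have := (pieces h ho.1 ho.2.1).2.2.1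
      have := low_nonneg Q α (3/4) (1/4)
      linarith
    · have e := eq_II (tyQ h) ho.1 ho.2.1
      have := opt_up ho v4 (by omega)
      have := (bound4 h ho.1 hns).2
      have := (pieces h ho.1 ho.2.1).2.2.1
      have := low_nonneg Q α (3/4) (1/4)
      linarith

lemma dichotomy {α : Set ℝ} (hf : α.Finite) (hne : α.Nonempty) :
    (∃ c, NS α c) ∨ ∃ b ∈ α, ∃ d ∈ α, b < d ∧ 1/2 ≤ b + d ∧ b + d ≤ 1 ∧ ∀ a ∈ α, a ≤ b ∨ d ≤ a := by
  let G : Set ℝ := {a ∈ α | ∀ b ∈ α, a < b → 1 < b + a}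
  have hG : G.Nonempty := by
    obtain ⟨x, hx, hmax⟩ := Set.exists_max_image α id hf hne
    exact ⟨x, hx, fun b hb hxb => absurd (hmax b hb) (not_le.2 hxb)⟩
  obtain ⟨c, hc, hmin⟩ := Set.exists_min_image G id (hf.subset fun x hx => hx.1) hG
  by_cases hl : {a ∈ α | a < c}.Nonempty
  · obtain ⟨b, hb, hbmax⟩ := Set.exists_max_image {a ∈ α | a < c} id (hf.subset fun x hx => hx.1) hl
    have hcons : ∀ a ∈ α, a ≤ b ∨ c ≤ a := by
      intro a ha
      rcases lt_or_ge a c with h | h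
      · exact Or.inl (hbmax a ⟨ha, h⟩)
      · exact Or.inr h
    have hbG : b ∉ G := fun hbG => absurd (hmin b hbG) (not_le.2 hb.2)
    have hbc : b + c ≤ 1 := by
      by_contra hcon
      apply hbG
      refine ⟨hb.1, fun x hx hbx => ?_⟩
      rcases hcons x hx with h | h <;> linarith
    by_cases hs : 1/2 ≤ b + c
    · exact Or.inr ⟨b, hb.1, c, hc.1, hb.2, hs, hbc, hcons⟩
    · refine Or.inl ⟨c, hc.1, fun a ha => ?_⟩
      rcases lt_trichotomy a c with h | h | h
      · have : a ≤ b := hbmax a ⟨ha, h⟩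
        exact Or.inr (Or.inl ⟨h, by linarith⟩)
      · exact Or.inl h
      · exact Or.inr (Or.inr ⟨h, hc.2 a ha h⟩)
  · refine Or.inl ⟨c, hc.1, fun a ha => ?_⟩
    rcases lt_trichotomy a c with h | h | h
    · exact absurd ⟨a, ha, h⟩ hl
    · exact Or.inl h
    · exact Or.inr (Or.inr ⟨h, hc.2 a ha h⟩)

lemma split {P Q ρ : Measure ℝ} {w m v : ℝ} (h : Sys P Q) (ht : Ty P Q ρ w m v) {α : Set ℝ}
    (ho : Opt ρ α) {b d : ℝ} (hb : b ∈ α) (hd : d ∈ α) (hbd : b < d) (h1 : 1/2 ≤ b + d)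
    (h2 : b + d ≤ 1) (hcons : ∀ a ∈ α, a ≤ b ∨ d ≤ a) :
    ∃ β γ : Set ℝ, Opt P β ∧ Opt Q γ ∧ β.ncard < α.ncard ∧ γ.ncard < α.ncard ∧
      ∀ a ∈ α, (∃ x ∈ β, a = fL x) ∨ (∃ x ∈ γ, a = gR x) := by
  have := h.probP
  have := h.probQ
  have i1 : Function.Injective fL := fun x y h => by simp only [fL] at h; linarith
  have i2 : Function.Injective gR := fun x y h => by simp only [gR] at h; linarith
  have s1 : ∀ a, fL (4 * a) = a := fun a => by simp only [fL]; ring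
  have s2 : ∀ a, gR (2 * a - 1) = a := fun a => by simp only [gR]; ring
  let β : Set ℝ := {x | fL x ∈ α ∧ fL x ≤ b}
  let γ : Set ℝ := {x | gR x ∈ α ∧ d ≤ gR x}
  have hβf : β.Finite := (ho.1.preimage i1.injOn).subset fun x hx => hx.1
  have hγf : γ.Finite := (ho.1.preimage i2.injOn).subset fun x hx => hx.1
  have hβm : ∀ a ∈ α, a ≤ b → 4 * a ∈ β := fun a ha hab => by
    change fL (4 * a) ∈ α ∧ fL (4 * a) ≤ b
    rw [s1]; exact ⟨ha, hab⟩
  have hγm : ∀ a ∈ α, d ≤ a → 2 * a - 1 ∈ γ := fun a ha hab => by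
    change gR (2 * a - 1) ∈ α ∧ d ≤ gR (2 * a - 1)
    rw [s2]; exact ⟨ha, hab⟩
  have hβn : β.Nonempty := ⟨_, hβm b hb le_rfl⟩
  have hγn : γ.Nonempty := ⟨_, hγm d hd le_rfl⟩
  have hα : α = fL '' β ∪ gR '' γ := by
    ext a
    constructor
    · intro ha
      rcases hcons a ha with h | h
      · exact Or.inl ⟨_, hβm a ha h, s1 a⟩
      · exact Or.inr ⟨_, hγm a ha h, s2 a⟩
    · rintro (⟨x, hx, rfl⟩ | ⟨x, hx, rfl⟩)
      · exact hx.1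
      · exact hx.1
  have hcard : α.ncard = β.ncard + γ.ncard := by
    rw [hα, Set.ncard_union_eq ?_ (hβf.image _) (hγf.image _), Set.ncard_image_of_injective _ i1,
      Set.ncard_image_of_injective _ i2]
    rw [Set.disjoint_left]
    rintro _ ⟨x, hx, rfl⟩ ⟨y, hy, hxy⟩
    have := hx.2
    have := hy.2
    linarith
  have kβ : 0 < β.ncard := (Set.ncard_pos hβf).2 hβn
  have kγ : 0 < γ.ncard := (Set.ncard_pos hγf).2 hγn
  have hc := dd_cont ho.1 ho.2.1
  have low : w/16 * ∫ x, dd β x ∂P + (1-w)/4 * ∫ x, dd γ x ∂Q ≤ ∫ x, dd α x ∂ρ := by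
    rw [ht.eq _ hc]
    have e1 : ∫ x, 1/16 * dd β x ∂P ≤ ∫ x, dd α (fL x) ∂P := by
      refine integral_mono_ae (intg P h.aeP _ (continuous_const.mul (dd_cont hβf hβn)))
        (intg P h.aeP _ (hc.comp fL_cont)) ?_
      filter_upwards [h.aeP] with x hx
      have hx2 := hx.2
      have key : ∃ a ∈ α, a ≤ b ∧ (fL x - a)^2 ≤ dd α (fL x) := by
        obtain ⟨a, ha, hh, -⟩ := dd_exists ho.1 ho.2.1 (fL x)
        rcases hcons a ha with h' | h'
        · exact ⟨a, ha, h', hh.ge⟩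
        · refine ⟨b, hb, le_rfl, ?_⟩
          rw [hh]
          have : fL x ≤ 1/4 := by simp only [fL]; linarith
          exact sqB (by linarith) (by linarith)
      obtain ⟨a, ha, hab, hle⟩ := key
      have := dd_le (hβm a ha hab) x
      have e : (fL x - a)^2 = 1/16 * (x - 4 * a)^2 := by simp only [fL]; ring
      linarith
    have e2 : ∫ x, 1/4 * dd γ x ∂Q ≤ ∫ x, dd α (gR x) ∂Q := by
      refine integral_mono_ae (intg Q h.aeQ _ (continuous_const.mul (dd_cont hγf hγn)))
        (intg Q h.aeQ _ (hc.comp gR_cont)) ?_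
      filter_upwards [h.aeQ] with x hx
      have hx1 := hx.1
      have key : ∃ a ∈ α, d ≤ a ∧ (gR x - a)^2 ≤ dd α (gR x) := by
        obtain ⟨a, ha, hh, -⟩ := dd_exists ho.1 ho.2.1 (gR x)
        rcases hcons a ha with h' | h'
        · refine ⟨d, hd, le_rfl, ?_⟩
          rw [hh]
          have : 1/2 ≤ gR x := by simp only [gR]; linarith
          exact sqA (by linarith) (by linarith)
        · exact ⟨a, ha, h', hh.ge⟩
      obtain ⟨a, ha, hab, hle⟩ := key
      have := dd_le (hγm a ha hab) x
      have e : (gR x - a)^2 = 1/4 * (x - (2 * a - 1))^2 := by simp only [gR]; ring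
      linarith
    rw [integral_const_mul] at e1 e2
    nlinarith [mul_le_mul_of_nonneg_left e1 ht.w0.le,
      mul_le_mul_of_nonneg_left e2 (sub_nonneg.2 ht.w1.le)]
  have w0 := ht.w0
  have w1 := ht.w1
  refine ⟨β, γ, ⟨hβf, hβn, ?_⟩, ⟨hγf, hγn, ?_⟩, by omega, by omega, ?_⟩
  · intro β' f' n' c'
    have := ho.2.2 (fL '' β' ∪ gR '' γ) ((f'.image _).union (hγf.image _)) (n'.image _).inl
      (card_merge.trans (by omega))
    have m' := merge h ht f' n' hγf hγn
    have : w/16 * ∫ x, dd β x ∂P ≤ w/16 * ∫ x, dd β' x ∂P := by linarith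
    exact le_of_mul_le_mul_left this (by linarith)
  · intro γ' f' n' c'
    have := ho.2.2 (fL '' β ∪ gR '' γ') ((hβf.image _).union (f'.image _)) (hβn.image _).inl
      (card_merge.trans (by omega))
    have m' := merge h ht hβf hβn f' n'
    have : (1-w)/4 * ∫ x, dd γ x ∂Q ≤ (1-w)/4 * ∫ x, dd γ' x ∂Q := by linarith
    exact le_of_mul_le_mul_left this (by linarith)
  · intro a ha
    rcases hcons a ha with h | h
    · exact Or.inl ⟨_, hβm a ha h, (s1 a).symm⟩
    · exact Or.inr ⟨_, hγm a ha h, (s2 a).symm⟩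

def Good (c : ℝ) : Prop := ∃ ω : List ℕ, IsWord ω ∧ (c = aw ω ∨ c = ainf ω)

lemma Sw_cons (j : ℕ) (ω : List ℕ) (x : ℝ) : Sw (j :: ω) x = S j (Sw ω x) := rfl

lemma wext_cons (j : ℕ) {ω : List ℕ} (hω : ω ≠ []) (k : ℕ) : wext (j :: ω) k = j :: wext ω k := by
  obtain ⟨i, τ, rfl⟩ := List.exists_cons_of_ne_nil hω
  simp [wext, wlast]

lemma S_add (j : ℕ) (x y : ℝ) : S j (x + y) = S j x + s j * y := by
  simp only [S, s]; ring

lemma sw_cons (j : ℕ) (ω : List ℕ) : sw (j :: ω) = s j * sw ω := by simp [sw]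

lemma ainf_cons (j : ℕ) {ω : List ℕ} (hω : ω ≠ []) : ainf (j :: ω) = S j (ainf ω) := by
  simp only [ainf]
  rw [wext_cons j hω, Sw_cons, sw_cons, S_add]; ring

lemma good_f {c : ℝ} (h : c = 4/7 ∨ Good c) : Good (fL c) := by
  rw [← S_one]
  rcases h with rfl | ⟨ω, ⟨h1, h2⟩, h | h⟩
  · exact ⟨[1], ⟨by simp, by simp⟩, Or.inl rfl⟩
  · refine ⟨1 :: ω, ⟨by simp, by simpa using h2⟩, Or.inl ?_⟩
    rw [h]; rfl
  · refine ⟨1 :: ω, ⟨by simp, by simpa using h2⟩, Or.inr ?_⟩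
    rw [h, ainf_cons 1 h1]

lemma good_g {c : ℝ} (h : c = 3/7 ∨ Good c) : Good (gR c) := by
  rcases h with rfl | ⟨ω, ⟨h1, h2⟩, h⟩
  · refine ⟨[1], ⟨by simp, by simp⟩, Or.inr ?_⟩
    simp [ainf, wext, wlast, Sw, sw, S, s, gR]; norm_num
  · obtain ⟨j, τ, rfl⟩ := List.exists_cons_of_ne_nil h1
    have hj : 1 ≤ j := h2 j (by simp)
    obtain ⟨i, rfl⟩ : ∃ i, j = i + 1 := ⟨j - 1, by omega⟩
    have hw : IsWord ((i + 2) :: τ) := by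
      refine ⟨by simp, ?_⟩
      intro k hk
      rcases List.mem_cons.1 hk with rfl | hk
      · omega
      · exact h2 k (by simp [hk])
    refine ⟨(i + 2) :: τ, hw, ?_⟩
    rcases h with rfl | rfl
    · left
      simp only [aw, Sw_cons, S_succ]
    · right
      by_cases hτ : τ = []
      · subst hτ
        have e1 : wext [i + 1] 1 = [i + 2] := by simp [wext, wlast]
        have e2 : wext [i + 2] 1 = [i + 3] := by simp [wext, wlast]
        have e3 : ∀ x, S (i + 3) x = gR (S (i + 2) x) := fun x => S_succ (i + 1) x
        simp only [ainf, e1, e2, Sw_cons, sw_cons, e3]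
        simp only [gR, s, sw, List.map_nil, List.prod_nil]
        rw [show i + 3 + 1 = (i + 2 + 1) + 1 from rfl, pow_succ (2:ℝ) (i + 2 + 1)]
        field_simp
        ring
      · rw [ainf_cons _ hτ, ainf_cons _ hτ, S_succ]

lemma opt_one {P Q ρ : Measure ℝ} {w m v : ℝ} (ht : Ty P Q ρ w m v) {α : Set ℝ} (ho : Opt ρ α)
    (hcard : α.ncard = 1) {c : ℝ} (hc : c ∈ α) : c = m := by
  obtain ⟨a, rfl⟩ := Set.ncard_eq_one.1 hcard
  have e := opt_up ho (up_one ht) hcard.ge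
  simp_rw [dd_single] at e
  rw [ht.sq] at e
  have : (m - a)^2 = 0 := le_antisymm (by linarith) (sq_nonneg _)
  rw [Set.mem_singleton_iff.1 hc]
  have := pow_eq_zero_iff (two_ne_zero) |>.1 this
  linarith

lemma main_ind {P Q : Measure ℝ} (h : Sys P Q) (n : ℕ) :
    (∀ α, Opt P α → α.ncard = n → ∀ c ∈ α, (c = 4/7 ∧ n < 2) ∨ Good c) ∧
    (∀ α, Opt Q α → α.ncard = n → ∀ c ∈ α, (c = 3/7 ∧ n < 2) ∨ Good c) := by
  induction n using Nat.strong_induction_on with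
  | _ n ih =>
    have step : ∀ (ρ : Measure ℝ) (w m v : ℝ), Ty P Q ρ w m v → ∀ α, Opt ρ α → α.ncard = n →
        (2 ≤ n → ∀ c, NS α c → False) → ∀ c ∈ α, (c = m ∧ n < 2) ∨ Good c := by
      intro ρ w m v ht α ho hn hno c hc
      rcases lt_or_ge n 2 with h2 | h2
      · left
        have : 0 < α.ncard := (Set.ncard_pos ho.1).2 ho.2.1
        exact ⟨opt_one ht ho (by omega) hc, h2⟩
      · right
        rcases dichotomy ho.1 ho.2.1 with ⟨x, hx⟩ | ⟨b, hb, d, hd, hbd, k1, k2, k3⟩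
        · exact (hno h2 x hx).elim
        · obtain ⟨β, γ, oβ, oγ, lβ, lγ, hall⟩ := split h ht ho hb hd hbd k1 k2 k3
          rcases hall c hc with ⟨x, hx, rfl⟩ | ⟨x, hx, rfl⟩
          · exact good_f (((ih _ (hn ▸ lβ)).1 β oβ rfl x hx).imp_left And.left)
          · exact good_g (((ih _ (hn ▸ lγ)).2 γ oγ rfl x hx).imp_left And.left)
    constructor
    · intro α ho hn
      exact step P _ _ _ (tyP h) α ho hn (fun h2 c hc => (no_NS h (hn ▸ h2) hc).1 ho)
    · intro α ho hn
      exact step Q _ _ _ (tyQ h) α ho hn (fun h2 c hc => (no_NS h (hn ▸ h2) hc).2 ho)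

/-- Every element of an optimal set of `n`-means (`n ≥ 2`) is of the form `a(ω)` or `a(ω,∞)`
for some nonempty word `ω`. -/
theorem stmt_17 (P : Measure ℝ) [IsProbabilityMeasure P]
    (hsupp : P (Set.Icc 0 1) = 1) (hinv : Invariant P)
    (n : ℕ) (hn : 2 ≤ n) (α : Set ℝ) (hopt : IsOptimal P n α) (c : ℝ) (hc : c ∈ α) :
    ∃ ω : List ℕ, IsWord ω ∧ (c = aw ω ∨ c = ainf ω) := by
  obtain ⟨Q, h⟩ := exists_sys P hsupp hinv
  obtain ⟨h1, h2, h3⟩ := hopt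
  have hf : α.Finite := Set.finite_of_ncard_pos h1
  have hne : α.Nonempty := (Set.ncard_pos hf).1 h1
  have hmin : ∀ β : Set ℝ, β.Finite → β.Nonempty → β.ncard ≤ n →
      ∫ x, dd α x ∂P ≤ ∫ x, dd β x ∂P := by
    intro β b1 b2 b3
    change distortion P α ≤ distortion P β
    rw [h3]
    refine csInf_le ⟨0, ?_⟩ ⟨β, (Set.ncard_pos b1).2 b2, b3, rfl⟩
    rintro _ ⟨γ, -, -, rfl⟩
    exact integral_nonneg fun x => dd_nonneg γ x
  have ho : Opt P α := ⟨hf, hne, fun β b1 b2 b3 => hmin β b1 b2 (b3.trans h2)⟩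
  have hcard : 2 ≤ α.ncard := by
    by_contra hlt
    have h4 : α.ncard = 1 := by omega
    obtain ⟨a, rfl⟩ := Set.ncard_eq_one.1 h4
    obtain ⟨γ, g1, g2, g3, g4⟩ := (ups h).1.1
    have e := (hmin γ g1 g2 (g3.trans hn)).trans g4
    simp_rw [dd_single] at e
    rw [(tyP h).sq] at e
    have := sq_nonneg (4/7 - a)
    linarith
  rcases (main_ind h _).1 α ho rfl c hc with h5 | h5
  · omega
  · exact h5
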